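/- Let G be a Garside group with Garside element Δ and N = ‖Δ‖. For every element g of G, the following are equivalent: (i) g is conjugate to a sup-straight element; (ii) sup_s(g) = t_sup(g); (iii) sup_s(g^N) = N·sup_s(g); (iv) sup_s(g^k) = k·sup_s(g) for every integer k ≥ 1; (v) every element h of the super summit set [g]^S is sup-straight. -/

import Mathlib

open Filter Topology Pointwise

/-- Left divisibility order on a group relative to a submonoid `P` of positive elements:
`a ≤_L b` iff `a⁻¹ * b ∈ P`. -/
def leL {G : Type*} [Group G] (P : Submonoid G) (a b : G) : Prop := a⁻¹ * b ∈ P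

/-- Right divisibility order: `a ≤_R b` iff `b * a⁻¹ ∈ P`. -/
def leR {G : Type*} [Group G] (P : Submonoid G) (a b : G) : Prop := b * a⁻¹ ∈ P

/-- An atom of the positive monoid `P`: a nontrivial element admitting no nontrivial
factorization inside `P`. -/
def IsMonAtom {G : Type*} [Group G] (P : Submonoid G) (a : G) : Prop :=
  a ∈ P ∧ a ≠ 1 ∧ ∀ b c : G, b ∈ P → c ∈ P → a = b * c → b = 1 ∨ c = 1

/-- `a` can be written as a product of `n` atoms of `P`. -/
def IsAtomProd {G : Type*} [Group G] (P : Submonoid G) (n : ℕ) (a : G) : Prop :=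
  ∃ l : List G, l.length = n ∧ (∀ x ∈ l, IsMonAtom P x) ∧ l.prod = a

/-- A Garside structure on a group `G`: `G` is the group of fractions of the positive
monoid `P`, which is a finitely generated atomic monoid (with atomic norm `norm`),
a lattice for both `≤_L` and `≤_R`, equipped with a Garside element `Δ` whose left and
right divisors coincide and generate `P`.  The fields `zinf`, `zsup`, `infs`, `sups`,
`tinf`, `tsup` are the (uniquely determined) invariants
`inf g = max {r : Δ^r ≤_L g}`, `sup g = min {s : g ≤_L Δ^s}`,
`inf_s g = max {inf h : h ∈ [g]}`, `sup_s g = min {sup h : h ∈ [g]}`,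
`t_inf g = lim inf(gⁿ)/n` and `t_sup g = lim sup(gⁿ)/n`,
each given together with its defining specification. -/
structure GarsideGroup (G : Type*) [Group G] where
  P : Submonoid G
  /-- `G` is the group of fractions of `P`. -/
  fraction : ∀ g : G, ∃ a b : G, a ∈ P ∧ b ∈ P ∧ g = a⁻¹ * b
  /-- `P` is finitely generated. -/
  fg : P.FG
  /-- the atomic norm `‖·‖` -/
  norm : G → ℕ
  /-- `P` is atomic: every positive element is a product of atoms and `norm a` is the
  greatest length of such an expression. -/
  norm_spec : ∀ a ∈ P, IsGreatest {n : ℕ | IsAtomProd P n a} (norm a)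
  /-- `(P, ≤_L)` is a lattice: gcd's and lcm's exist. -/
  latticeL : ∀ a ∈ P, ∀ b ∈ P,
    (∃ c ∈ P, leL P c a ∧ leL P c b ∧ ∀ d ∈ P, leL P d a → leL P d b → leL P d c) ∧
    (∃ c ∈ P, leL P a c ∧ leL P b c ∧ ∀ d ∈ P, leL P a d → leL P b d → leL P c d)
  /-- `(P, ≤_R)` is a lattice. -/
  latticeR : ∀ a ∈ P, ∀ b ∈ P,
    (∃ c ∈ P, leR P c a ∧ leR P c b ∧ ∀ d ∈ P, leR P d a → leR P d b → leR P d c) ∧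
    (∃ c ∈ P, leR P a c ∧ leR P b c ∧ ∀ d ∈ P, leR P a d → leR P b d → leR P c d)
  /-- the Garside element -/
  Δ : G
  Δ_mem : Δ ∈ P
  /-- the left and right divisors of `Δ` coincide -/
  Δ_balanced : ∀ a ∈ P, (leL P a Δ ↔ leR P a Δ)
  /-- the simple elements generate `P` -/
  simples_gen : Submonoid.closure {a : G | a ∈ P ∧ leL P a Δ} = P
  /-- `inf g = max {r : ℤ | Δ^r ≤_L g}` -/
  zinf : G → ℤ
  /-- `sup g = min {s : ℤ | g ≤_L Δ^s}` -/
  zsup : G → ℤ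
  zinf_spec : ∀ g : G, IsGreatest {r : ℤ | leL P (Δ ^ r) g} (zinf g)
  zsup_spec : ∀ g : G, IsLeast {s : ℤ | leL P g (Δ ^ s)} (zsup g)
  /-- `inf_s g = max {inf h : h ∈ [g]}` -/
  infs : G → ℤ
  /-- `sup_s g = min {sup h : h ∈ [g]}` -/
  sups : G → ℤ
  infs_spec : ∀ g : G, IsGreatest (Set.range fun h : G => zinf (h⁻¹ * g * h)) (infs g)
  sups_spec : ∀ g : G, IsLeast (Set.range fun h : G => zsup (h⁻¹ * g * h)) (sups g)
  /-- `t_inf g = lim_{n → ∞} inf(gⁿ)/n` -/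
  tinf : G → ℝ
  /-- `t_sup g = lim_{n → ∞} sup(gⁿ)/n` -/
  tsup : G → ℝ
  tinf_spec : ∀ g : G,
    Filter.Tendsto (fun n : ℕ => (zinf (g ^ n) : ℝ) / (n : ℝ)) Filter.atTop (nhds (tinf g))
  tsup_spec : ∀ g : G,
    Filter.Tendsto (fun n : ℕ => (zsup (g ^ n) : ℝ) / (n : ℝ)) Filter.atTop (nhds (tsup g))

namespace GarsideGroup

variable {G : Type*} [Group G] (Γ : GarsideGroup G)

/-- The set `𝒟` of simple elements. -/
def simples : Set G := {a : G | a ∈ Γ.P ∧ leL Γ.P a Γ.Δ}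

/-- `len g = sup g - inf g` -/
def len (g : G) : ℤ := Γ.zsup g - Γ.zinf g

/-- `t_len g = t_sup g - t_inf g` -/
noncomputable def tlen (g : G) : ℝ := Γ.tsup g - Γ.tinf g

/-- `g` is inf-straight if `inf g = t_inf g`. -/
def InfStraight (g : G) : Prop := (Γ.zinf g : ℝ) = Γ.tinf g

/-- `g` is sup-straight if `sup g = t_sup g`. -/
def SupStraight (g : G) : Prop := (Γ.zsup g : ℝ) = Γ.tsup g

/-- The super summit set `[g]^S`. -/
def superSummit (g : G) : Set G :=
  {h : G | (∃ x : G, x⁻¹ * g * x = h) ∧ Γ.zinf h = Γ.infs g ∧ Γ.zsup h = Γ.sups g}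

end GarsideGroup

/-- The shortest length of a word over the alphabet `X` representing `g`. -/
noncomputable def wlen {G : Type*} [Group G] (X : Set G) (g : G) : ℕ :=
  sInf {n : ℕ | ∃ l : List G, l.length = n ∧ (∀ x ∈ l, x ∈ X) ∧ l.prod = g}

section AbstractLattice

variable {α : Type*} [SemilatticeSup α]

/-- partial joins of the orbit of `y` under `f` -/
def orbSup (f : α → α) (y : α) : ℕ → α
  | 0 => y
  | k + 1 => y ⊔ f (orbSup f y k)

theorem base_le_orbSup (f : α → α) (y : α) (k : ℕ) : y ≤ orbSup f y k := by
  cases k with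
  | zero => exact le_rfl
  | succ k => exact le_sup_left

theorem monotone_of_sup {f : α → α} (hf : ∀ a b, f (a ⊔ b) = f a ⊔ f b) : Monotone f := by
  intro a b hab
  have := hf a b
  rw [sup_eq_right.2 hab] at this
  rw [this]
  exact le_sup_left

theorem orbSup_succ_le {f : α → α} (hf : ∀ a b, f (a ⊔ b) = f a ⊔ f b) (y : α) (k : ℕ) :
    orbSup f y (k + 1) ≤ orbSup f y k ⊔ f^[k + 1] y := by
  induction k with
  | zero => exact le_rfl
  | succ k ih =>
    have h1 := monotone_of_sup hf ih
    rw [hf] at h1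
    rw [Function.iterate_succ_apply' f (k + 1)]
    change y ⊔ f (orbSup f y (k + 1)) ≤ (y ⊔ f (orbSup f y k)) ⊔ f (f^[k + 1] y)
    rw [sup_assoc]
    exact sup_le_sup_left h1 y

theorem iterate_sup {f : α → α} (hf : ∀ a b, f (a ⊔ b) = f a ⊔ f b) (n : ℕ) (a b : α) :
    f^[n] (a ⊔ b) = f^[n] a ⊔ f^[n] b := by
  induction n with
  | zero => rfl
  | succ n ih => simp only [Function.iterate_succ_apply', ih, hf]

theorem exists_descending {f S : α → α} (hf : ∀ a b, f (a ⊔ b) = f a ⊔ f b)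
    (hS : ∀ a b, S (a ⊔ b) = S a ⊔ S b) (hfS : ∀ a, f (S a) = S (f a)) (hSle : ∀ a, S a ≤ a)
    {n : ℕ} {y : α} (hy : f^[n + 1] y ≤ S y) :
    ∃ z, f z ≤ z ∧ f^[n + 1] z ≤ S z := by
  refine ⟨orbSup f y n, ?_, ?_⟩
  · calc f (orbSup f y n) ≤ orbSup f y (n + 1) := le_sup_right
      _ ≤ orbSup f y n ⊔ f^[n + 1] y := orbSup_succ_le hf y n
      _ ≤ orbSup f y n :=
        sup_le le_rfl ((hy.trans (hSle y)).trans (base_le_orbSup f y n))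
  · have key : ∀ k, f^[n + 1] (orbSup f y k) ≤ S (orbSup f y k) := by
      intro k
      induction k with
      | zero => exact hy
      | succ k ih =>
        change f^[n + 1] (y ⊔ f (orbSup f y k)) ≤ S (y ⊔ f (orbSup f y k))
        rw [iterate_sup hf, hS, ← hfS]
        refine sup_le_sup hy ?_
        rw [← Function.iterate_succ_apply, Function.iterate_succ_apply']
        exact monotone_of_sup hf ih
    exact key n

theorem iterate_height_le {f S : α → α} (hf : ∀ a b, f (a ⊔ b) = f a ⊔ f b)
    (hS : ∀ a b, S (a ⊔ b) = S a ⊔ S b) (hfS : ∀ a, f (S a) = S (f a)) (hSle : ∀ a, S a ≤ a)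
    {n : ℕ} {z : α} (hz : f z ≤ z) (hn : f^[n] z ≤ S z) (d : α → ℕ)
    (hd : ∀ a b, S z ≤ a → a < b → d a < d b) : f^[d z] z ≤ S z := by
  have hanti : ∀ i, f^[i + 1] z ≤ f^[i] z := by
    intro i
    induction i with
    | zero => exact hz
    | succ i ih =>
      rw [Function.iterate_succ_apply' f (i + 1), Function.iterate_succ_apply' f i]
      exact monotone_of_sup hf (by rw [← Function.iterate_succ_apply' f i]; exact ih)
  have hanti' : Antitone (fun i => f^[i] z) := antitone_nat_of_succ_le hanti
  have hSf : S (f z) ≤ S z := monotone_of_sup hS hz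
  have hstab : ∀ i, f^[i] z ≤ f^[i + 1] z ⊔ S z → ∀ j, f^[i] z ≤ f^[i + j] z ⊔ S z := by
    intro i hi
    have step : ∀ j, f^[i + j] z ≤ f^[i + j + 1] z ⊔ S z := by
      intro j
      induction j with
      | zero => exact hi
      | succ j ih =>
        have h1 := monotone_of_sup hf ih
        rw [hf, hfS, ← Function.iterate_succ_apply' f, ← Function.iterate_succ_apply' f] at h1
        exact h1.trans (sup_le_sup_left hSf _)
    intro j
    induction j with
    | zero => exact le_sup_left
    | succ j ih => exact ih.trans (sup_le (step j) le_sup_right)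
  have key : ∀ i, f^[i] z ≤ S z ∨ d (f^[i] z ⊔ S z) + i ≤ d z := by
    intro i
    induction i with
    | zero =>
      right
      have : z ⊔ S z = z := sup_eq_left.2 (hSle z)
      simp [this]
    | succ i ih =>
      rcases ih with h | h
      · exact Or.inl ((hanti i).trans h)
      by_cases hc : f^[i] z ≤ f^[i + 1] z ⊔ S z
      · left
        have h1 := hstab i hc n
        have h2 : f^[i + n] z ≤ f^[n] z := hanti' (Nat.le_add_left n i)
        exact (hanti i).trans (h1.trans (sup_le (h2.trans hn) le_rfl))
      · right
        have hlt : f^[i + 1] z ⊔ S z < f^[i] z ⊔ S z := by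
          refine lt_of_le_not_ge (sup_le_sup_right (hanti i) _) ?_
          intro h'
          exact hc (le_sup_left.trans h')
        have := hd _ _ le_sup_right hlt
        omega
  rcases key (d z) with h | h
  · exact h
  by_contra hc
  have hlt : S z < f^[d z] z ⊔ S z := by
    refine lt_of_le_not_ge le_sup_right ?_
    intro h'
    exact hc (le_sup_left.trans h')
  have := hd _ _ le_rfl hlt
  omega

theorem exists_both {f h : α → α} (hf : ∀ a b, f (a ⊔ b) = f a ⊔ f b)
    (hh : ∀ a b, h (a ⊔ b) = h a ⊔ h b) (hfh : ∀ a, f (h a) = h (f a))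
    {x B : α} (hx : x ≤ f x) (hB : h B ≤ B) (hxB : x ≤ B) (d : α → ℕ)
    (hd : ∀ a b, a < b → b ≤ B → d b < d a) : ∃ z, z ≤ f z ∧ h z ≤ z := by
  have huf : ∀ k, orbSup h x k ≤ f (orbSup h x k) := by
    intro k
    induction k with
    | zero => exact hx
    | succ k ih =>
      change x ⊔ h (orbSup h x k) ≤ f (x ⊔ h (orbSup h x k))
      rw [hf, hfh]
      exact sup_le_sup hx (monotone_of_sup hh ih)
  have huB : ∀ k, orbSup h x k ≤ B := by
    intro k
    induction k with
    | zero => exact hxB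
    | succ k ih => exact sup_le hxB ((monotone_of_sup hh ih).trans hB)
  have hmono : ∀ k, orbSup h x k ≤ orbSup h x (k + 1) := by
    intro k
    induction k with
    | zero => exact le_sup_left
    | succ k ih => exact sup_le_sup_left (monotone_of_sup hh ih) x
  by_contra hc
  push Not at hc
  have hlt : ∀ k, orbSup h x k < orbSup h x (k + 1) := by
    intro k
    refine lt_of_le_not_ge (hmono k) ?_
    intro h'
    exact hc _ (huf k) (le_sup_right.trans h')
  have key : ∀ k, d (orbSup h x k) + k ≤ d x := by
    intro k
    induction k with
    | zero => exact le_rfl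
    | succ k ih =>
      have := hd _ _ (hlt k) (huB (k + 1))
      omega
  have := key (d x + 1)
  omega

end AbstractLattice

namespace GarsideGroup

variable {G : Type*} [Group G] (Γ : GarsideGroup G)

theorem norm_mul_le {a b : G} (ha : a ∈ Γ.P) (hb : b ∈ Γ.P) :
    Γ.norm a + Γ.norm b ≤ Γ.norm (a * b) := by
  obtain ⟨l, hl, hla, hlp⟩ := (Γ.norm_spec a ha).1
  obtain ⟨m, hm, hma, hmp⟩ := (Γ.norm_spec b hb).1
  refine (Γ.norm_spec (a * b) (Γ.P.mul_mem ha hb)).2 ⟨l ++ m, ?_, ?_, ?_⟩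
  · simp [hl, hm]
  · intro x hx
    rcases List.mem_append.1 hx with h | h
    · exact hla x h
    · exact hma x h
  · simp [hlp, hmp]

theorem eq_one_of_norm {a : G} (ha : a ∈ Γ.P) (h : Γ.norm a = 0) : a = 1 := by
  obtain ⟨l, hl, hla, hlp⟩ := (Γ.norm_spec a ha).1
  rw [h] at hl
  rw [List.length_eq_zero_iff.1 hl] at hlp
  simpa using hlp.symm

theorem norm_one : Γ.norm 1 = 0 := by
  have := Γ.norm_mul_le Γ.P.one_mem Γ.P.one_mem
  rw [mul_one] at this
  omega

theorem eq_one_of_inv_mem {a : G} (ha : a ∈ Γ.P) (ha' : a⁻¹ ∈ Γ.P) : a = 1 := by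
  have := Γ.norm_mul_le ha ha'
  rw [mul_inv_cancel, norm_one] at this
  exact Γ.eq_one_of_norm ha (by omega)

theorem conj_mem {p : G} (hp : p ∈ Γ.P) : Γ.Δ⁻¹ * p * Γ.Δ ∈ Γ.P := by
  have hp' := hp
  rw [← Γ.simples_gen] at hp'
  induction hp' using Submonoid.closure_induction with
  | mem a ha =>
    obtain ⟨ha, hb⟩ := ha
    have h1 : leR Γ.P (a⁻¹ * Γ.Δ) Γ.Δ := by
      simpa [leR] using ha
    have h2 := (Γ.Δ_balanced _ hb).2 h1
    simpa [leL, mul_assoc] using h2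
  | one => simp
  | mul x y hx hy ihx ihy =>
    rw [Γ.simples_gen] at hx hy
    have := Γ.P.mul_mem (ihx hx) (ihy hy)
    simpa [mul_assoc] using this

theorem conj_mem' {p : G} (hp : p ∈ Γ.P) : Γ.Δ * p * Γ.Δ⁻¹ ∈ Γ.P := by
  have hp' := hp
  rw [← Γ.simples_gen] at hp'
  induction hp' using Submonoid.closure_induction with
  | mem a ha =>
    obtain ⟨ha, hb⟩ := ha
    have hb' : Γ.Δ * a⁻¹ ∈ Γ.P := (Γ.Δ_balanced a ha).1 hb
    have h1 : leL Γ.P (Γ.Δ * a⁻¹) Γ.Δ := by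
      simpa [leL] using ha
    have h2 := (Γ.Δ_balanced _ hb').1 h1
    simpa [leR, mul_assoc] using h2
  | one => simp
  | mul x y hx hy ihx ihy =>
    rw [Γ.simples_gen] at hx hy
    have := Γ.P.mul_mem (ihx hx) (ihy hy)
    simpa [mul_assoc] using this

theorem conj_pow_mem (n : ℕ) {p : G} (hp : p ∈ Γ.P) :
    (Γ.Δ ^ n)⁻¹ * p * Γ.Δ ^ n ∈ Γ.P ∧ Γ.Δ ^ n * p * (Γ.Δ ^ n)⁻¹ ∈ Γ.P := by
  induction n with
  | zero => simpa using hp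
  | succ n ih =>
    constructor
    · have := Γ.conj_mem ih.1
      simpa [pow_succ, mul_assoc] using this
    · have := Γ.conj_mem' ih.2
      simpa [pow_succ', mul_assoc] using this

theorem conj_zpow_mem (k : ℤ) {p : G} (hp : p ∈ Γ.P) :
    (Γ.Δ ^ k)⁻¹ * p * Γ.Δ ^ k ∈ Γ.P := by
  obtain ⟨n, rfl | rfl⟩ := k.eq_nat_or_neg
  · simpa using (Γ.conj_pow_mem n hp).1
  · simpa using (Γ.conj_pow_mem n hp).2

theorem leL_mul_zpow {a b : G} (k : ℤ) (h : leL Γ.P a b) :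
    leL Γ.P (a * Γ.Δ ^ k) (b * Γ.Δ ^ k) := by
  have := Γ.conj_zpow_mem k h
  simpa [leL, mul_assoc] using this

/-- The underlying type of `G`, ordered by left divisibility. -/
@[ext]
structure Ord {G : Type*} [Group G] (Γ : GarsideGroup G) where
  /-- the underlying element -/
  val : G

instance instPO : PartialOrder Γ.Ord where
  le a b := leL Γ.P a.val b.val
  le_refl a := by
    change leL Γ.P a.val a.val
    simp [leL]
  le_trans a b c h1 h2 := by
    have := Γ.P.mul_mem h1 h2
    change a.val⁻¹ * c.val ∈ Γ.P
    simpa [mul_assoc] using this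
  le_antisymm a b h1 h2 := by
    have h3 : (a.val⁻¹ * b.val)⁻¹ ∈ Γ.P := by
      simpa [leL] using h2
    exact Ord.ext (inv_mul_eq_one.1 (Γ.eq_one_of_inv_mem h1 h3))

theorem exists_join (a b : G) : ∃ c, leL Γ.P a c ∧ leL Γ.P b c ∧
    ∀ d, leL Γ.P a d → leL Γ.P b d → leL Γ.P c d := by
  obtain ⟨u, v, hu, hv, huv⟩ := Γ.fraction (a⁻¹ * b)
  obtain ⟨c, hc, h1, h2, h3⟩ := (Γ.latticeL u hu v hv).2
  have hb : b = a * (u⁻¹ * v) := by rw [← huv]; group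
  subst hb
  refine ⟨a * u⁻¹ * c, ?_, ?_, ?_⟩
  · simpa [leL, mul_assoc] using h1
  · simpa [leL, mul_assoc] using h2
  · intro d had hbd
    have e1 : leL Γ.P u (u * a⁻¹ * d) := by simpa [leL, mul_assoc] using had
    have e2 : leL Γ.P v (u * a⁻¹ * d) := by simpa [leL, mul_assoc] using hbd
    have e3 : u * a⁻¹ * d ∈ Γ.P := by
      have := Γ.P.mul_mem hu had
      simpa [mul_assoc] using this
    have := h3 _ e3 e1 e2
    simpa [leL, mul_assoc] using this

noncomputable instance instSup : SemilatticeSup Γ.Ord where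
  sup a b := ⟨Classical.choose (Γ.exists_join a.val b.val)⟩
  le_sup_left a b := (Classical.choose_spec (Γ.exists_join a.val b.val)).1
  le_sup_right a b := (Classical.choose_spec (Γ.exists_join a.val b.val)).2.1
  sup_le a b c := (Classical.choose_spec (Γ.exists_join a.val b.val)).2.2 c.val

/-- left multiplication by `g` composed with right multiplication by `Δ ^ k` -/
def act (g : G) (k : ℤ) (a : Γ.Ord) : Γ.Ord := ⟨g * a.val * Γ.Δ ^ k⟩

theorem act_mono (g : G) (k : ℤ) : Monotone (Γ.act g k) := by
  intro a b hab
  have := Γ.leL_mul_zpow k hab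
  change leL Γ.P (g * a.val * Γ.Δ ^ k) (g * b.val * Γ.Δ ^ k)
  simpa [leL, mul_assoc] using this

theorem act_act (g h : G) (k l : ℤ) (a : Γ.Ord) :
    Γ.act g k (Γ.act h l a) = Γ.act (g * h) (l + k) a := by
  simp [act, mul_assoc, zpow_add]

theorem act_one (a : Γ.Ord) : Γ.act 1 0 a = a := by
  simp [act]

theorem act_sup (g : G) (k : ℤ) (a b : Γ.Ord) :
    Γ.act g k (a ⊔ b) = Γ.act g k a ⊔ Γ.act g k b := by
  apply le_antisymm
  · have h1 : a ≤ Γ.act g⁻¹ (-k) (Γ.act g k a ⊔ Γ.act g k b) := by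
      have := Γ.act_mono g⁻¹ (-k) (le_sup_left : Γ.act g k a ≤ Γ.act g k a ⊔ Γ.act g k b)
      simpa [act_act, act_one] using this
    have h2 : b ≤ Γ.act g⁻¹ (-k) (Γ.act g k a ⊔ Γ.act g k b) := by
      have := Γ.act_mono g⁻¹ (-k) (le_sup_right : Γ.act g k b ≤ Γ.act g k a ⊔ Γ.act g k b)
      simpa [act_act, act_one] using this
    have := Γ.act_mono g k (sup_le h1 h2)
    simpa [act_act, act_one] using this
  · exact sup_le (Γ.act_mono g k le_sup_left) (Γ.act_mono g k le_sup_right)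

theorem act_iterate (g : G) (k : ℤ) (n : ℕ) (a : Γ.Ord) :
    (Γ.act g k)^[n] a = Γ.act (g ^ n) (n * k) a := by
  induction n with
  | zero => simp [act_one]
  | succ n ih =>
    rw [Function.iterate_succ_apply', ih, act_act, pow_succ']
    congr 1
    push_cast
    ring

theorem act_le_act (g h : G) (k l : ℤ) (a : Γ.Ord) :
    Γ.act g k a ≤ Γ.act h l a ↔ leL Γ.P (g * a.val * Γ.Δ ^ k)
      (h * a.val * Γ.Δ ^ l) := Iff.rfl

theorem zsup_le_iff (g : G) (s : ℤ) : Γ.zsup g ≤ s ↔ leL Γ.P g (Γ.Δ ^ s) := by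
  constructor
  · intro h
    have h1 : leL Γ.P g (Γ.Δ ^ Γ.zsup g) := (Γ.zsup_spec g).1
    obtain ⟨n, hn⟩ := Int.le.dest h
    have h2 := Γ.P.mul_mem h1 (Γ.P.pow_mem Γ.Δ_mem n)
    rw [← hn]
    simpa [leL, zpow_add, mul_assoc] using h2
  · intro h
    exact (Γ.zsup_spec g).2 h

theorem le_zinf_iff (g : G) (s : ℤ) : s ≤ Γ.zinf g ↔ leL Γ.P (Γ.Δ ^ s) g := by
  constructor
  · intro h
    have h1 : leL Γ.P (Γ.Δ ^ Γ.zinf g) g := (Γ.zinf_spec g).1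
    obtain ⟨n, hn⟩ := Int.le.dest h
    have h2 := Γ.P.mul_mem (Γ.P.pow_mem Γ.Δ_mem n) h1
    rw [← hn] at h2
    simpa [leL, zpow_add, mul_assoc] using h2
  · intro h
    exact (Γ.zinf_spec g).2 h

theorem zsup_conj_le_iff (g : G) (s : ℤ) (x : Γ.Ord) :
    Γ.zsup (x.val⁻¹ * g * x.val) ≤ s ↔ Γ.act g (-s) x ≤ x := by
  rw [zsup_le_iff]
  constructor
  · intro h
    have := Γ.leL_mul_zpow (-s) h
    change leL Γ.P (g * x.val * Γ.Δ ^ (-s)) x.val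
    simpa [leL, mul_assoc] using this
  · intro h
    have := Γ.leL_mul_zpow s h
    simpa [act, leL, mul_assoc] using this

theorem le_zinf_conj_iff (g : G) (s : ℤ) (x : Γ.Ord) :
    s ≤ Γ.zinf (x.val⁻¹ * g * x.val) ↔ x ≤ Γ.act g (-s) x := by
  rw [le_zinf_iff]
  constructor
  · intro h
    have := Γ.leL_mul_zpow (-s) h
    change leL Γ.P x.val (g * x.val * Γ.Δ ^ (-s))
    simpa [leL, mul_assoc] using this
  · intro h
    have := Γ.leL_mul_zpow s h
    simpa [act, leL, mul_assoc] using this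

theorem zsup_mul_le (g h : G) : Γ.zsup (g * h) ≤ Γ.zsup g + Γ.zsup h := by
  rw [zsup_le_iff]
  have h1 : leL Γ.P g (Γ.Δ ^ Γ.zsup g) := (Γ.zsup_spec g).1
  have h2 : leL Γ.P h (Γ.Δ ^ Γ.zsup h) := (Γ.zsup_spec h).1
  have h3 := Γ.P.mul_mem h2 (Γ.conj_zpow_mem (Γ.zsup h) h1)
  simpa [leL, zpow_add, mul_assoc] using h3

theorem zsup_pow_le (g : G) (n : ℕ) : Γ.zsup (g ^ n) ≤ n * Γ.zsup g := by
  induction n with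
  | zero =>
    rw [zsup_le_iff]
    simp [leL]
  | succ n ih =>
    rw [pow_succ]
    have := Γ.zsup_mul_le (g ^ n) g
    push_cast
    linarith

theorem sups_le (g x : G) : Γ.sups g ≤ Γ.zsup (x⁻¹ * g * x) := (Γ.sups_spec g).2 ⟨x, rfl⟩

theorem exists_sups (g : G) : ∃ x, Γ.zsup (x⁻¹ * g * x) = Γ.sups g := (Γ.sups_spec g).1

theorem tsup_pow (g : G) (k : ℕ) : Γ.tsup (g ^ k) = k * Γ.tsup g := by
  rcases Nat.eq_zero_or_pos k with rfl | hk
  · have h := Γ.tsup_spec (g ^ 0)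
    have h0 : Γ.tsup (g ^ 0) = 0 := by
      refine tendsto_nhds_unique h ?_
      simp only [pow_zero, one_pow]
      exact tendsto_const_div_atTop_nhds_zero_nat _
    simpa using h0
  · have h1 := (Γ.tsup_spec g).comp (tendsto_id.const_mul_atTop' hk)
    refine tendsto_nhds_unique (Γ.tsup_spec (g ^ k)) ?_
    refine (h1.const_mul (k : ℝ)).congr ?_
    intro n
    have hk' : (k : ℝ) ≠ 0 := by positivity
    simp only [Function.comp, id, ← pow_mul]
    push_cast
    rw [← mul_div_assoc, mul_div_mul_left _ _ hk']

theorem tsup_conj_le (g x : G) : Γ.tsup (x⁻¹ * g * x) ≤ Γ.tsup g := by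
  set C : ℝ := (Γ.zsup x⁻¹ : ℝ) + Γ.zsup x
  have h2 := (Γ.tsup_spec g).add (tendsto_const_div_atTop_nhds_zero_nat C)
  rw [add_zero] at h2
  refine le_of_tendsto_of_tendsto' (Γ.tsup_spec (x⁻¹ * g * x)) h2 ?_
  intro n
  rw [← add_div]
  have e : (x⁻¹ * g * x) ^ n = x⁻¹ * g ^ n * x := by
    simpa using conj_pow (a := x⁻¹) (b := g) (i := n)
  have h3 : Γ.zsup (x⁻¹ * g ^ n * x) ≤ Γ.zsup (g ^ n) + (Γ.zsup x⁻¹ + Γ.zsup x) := by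
    have := Γ.zsup_mul_le (x⁻¹ * g ^ n) x
    have := Γ.zsup_mul_le x⁻¹ (g ^ n)
    linarith
  rw [e]
  have h4 : (Γ.zsup (x⁻¹ * g ^ n * x) : ℝ) ≤ (Γ.zsup (g ^ n) : ℝ) + C := by
    simp only [C]
    exact_mod_cast h3
  gcongr

theorem tsup_conj (g x : G) : Γ.tsup (x⁻¹ * g * x) = Γ.tsup g := by
  refine le_antisymm (Γ.tsup_conj_le g x) ?_
  have := Γ.tsup_conj_le (x⁻¹ * g * x) x⁻¹
  simpa [mul_assoc] using this

theorem tsup_le_zsup (g : G) : Γ.tsup g ≤ Γ.zsup g := by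
  refine le_of_tendsto (Γ.tsup_spec g) ?_
  filter_upwards [eventually_gt_atTop 0] with n hn
  have hn' : (0 : ℝ) < n := by exact_mod_cast hn
  rw [div_le_iff₀ hn', mul_comm]
  exact_mod_cast Γ.zsup_pow_le g n

theorem tsup_le_sups (g : G) : Γ.tsup g ≤ Γ.sups g := by
  obtain ⟨x, hx⟩ := Γ.exists_sups g
  rw [← hx, ← Γ.tsup_conj g x]
  exact Γ.tsup_le_zsup _

theorem sups_pow_le (g : G) (k : ℕ) : Γ.sups (g ^ k) ≤ k * Γ.sups g := by
  obtain ⟨x, hx⟩ := Γ.exists_sups g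
  have h1 := Γ.sups_le (g ^ k) x
  have h2 := Γ.zsup_pow_le (x⁻¹ * g * x) k
  have e : (x⁻¹ * g * x) ^ k = x⁻¹ * g ^ k * x := by
    simpa using conj_pow (a := x⁻¹) (b := g) (i := k)
  rw [e, hx] at h2
  exact h1.trans h2

theorem norm_strict {a b c : Γ.Ord} (hab : a ≤ b) (hbc : b < c) :
    Γ.norm (a.val⁻¹ * b.val) <
      Γ.norm (a.val⁻¹ * c.val) := by
  have h1 : a.val⁻¹ * b.val ∈ Γ.P := hab
  have h2 : b.val⁻¹ * c.val ∈ Γ.P := hbc.le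
  have h3 := Γ.norm_mul_le h1 h2
  have h4 : Γ.norm (b.val⁻¹ * c.val) ≠ 0 := by
    intro h0
    exact hbc.ne (Ord.ext <| inv_mul_eq_one.1 (Γ.eq_one_of_norm h2 h0))
  have e : a.val⁻¹ * b.val * (b.val⁻¹ * c.val) =
    a.val⁻¹ * c.val := by group
  rw [e] at h3
  omega

theorem norm_strict' {a b c : Γ.Ord} (hab : a < b) (hbc : b ≤ c) :
    Γ.norm (b.val⁻¹ * c.val) <
      Γ.norm (a.val⁻¹ * c.val) := by
  have h1 : a.val⁻¹ * b.val ∈ Γ.P := hab.le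
  have h2 : b.val⁻¹ * c.val ∈ Γ.P := hbc
  have h3 := Γ.norm_mul_le h1 h2
  have h4 : Γ.norm (a.val⁻¹ * b.val) ≠ 0 := by
    intro h0
    exact hab.ne (Ord.ext <| inv_mul_eq_one.1 (Γ.eq_one_of_norm h1 h0))
  have e : a.val⁻¹ * b.val * (b.val⁻¹ * c.val) =
    a.val⁻¹ * c.val := by group
  rw [e] at h3
  omega

theorem sups_pow_lt (g : G) (h : Γ.tsup g < Γ.sups g) :
    Γ.sups (g ^ Γ.norm Γ.Δ) < Γ.norm Γ.Δ * Γ.sups g := by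
  set m := Γ.sups g with hm
  set N := Γ.norm Γ.Δ with hN
  have hev := ((Γ.tsup_spec g).eventually (gt_mem_nhds h)).and (eventually_gt_atTop 0)
  obtain ⟨n', hn1, hn0⟩ := hev.exists
  obtain ⟨n, rfl⟩ : ∃ n, n' = n + 1 := ⟨n' - 1, by omega⟩
  have hpos : (0 : ℝ) < ((n + 1 : ℕ) : ℝ) := by positivity
  rw [div_lt_iff₀ hpos] at hn1
  have hn2 : Γ.zsup (g ^ (n + 1)) < m * ((n + 1 : ℕ) : ℤ) := by exact_mod_cast hn1
  have hf := Γ.act_sup g (-m)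
  have hS := Γ.act_sup 1 (-1)
  have hfS : ∀ a, Γ.act g (-m) (Γ.act 1 (-1) a) = Γ.act 1 (-1) (Γ.act g (-m) a) := by
    intro a
    rw [act_act, act_act, mul_one, one_mul, add_comm]
  have hSle : ∀ a, Γ.act 1 (-1) a ≤ a := by
    intro a
    rw [← zsup_conj_le_iff, zsup_le_iff]
    simpa [leL] using Γ.Δ_mem
  have hy : (Γ.act g (-m))^[n + 1] (⟨1⟩ : Γ.Ord) ≤
      Γ.act 1 (-1) (⟨1⟩ : Γ.Ord) := by
    rw [act_iterate, act_le_act]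
    have h1 : leL Γ.P (g ^ (n + 1)) (Γ.Δ ^ (m * ((n + 1 : ℕ) : ℤ) - 1)) := by
      rw [← zsup_le_iff]; omega
    have h2 := Γ.leL_mul_zpow (((n + 1 : ℕ) : ℤ) * -m) h1
    rw [← zpow_add] at h2
    have e : m * ((n + 1 : ℕ) : ℤ) - 1 + ((n + 1 : ℕ) : ℤ) * -m = -1 := by ring
    rw [e] at h2
    simpa using h2
  obtain ⟨z, hz1, hz2⟩ := exists_descending hf hS hfS hSle hy
  have h3 := iterate_height_le hf hS hfS hSle hz1 hz2
    (fun b => Γ.norm ((Γ.act 1 (-1) z).val⁻¹ * b.val))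
    (fun a b hab hbc => Γ.norm_strict hab hbc)
  have e : (Γ.act 1 (-1) z).val⁻¹ * z.val = Γ.Δ := by
    simp [act]
  simp only [e] at h3
  rw [act_iterate] at h3
  have h4 := Γ.act_mono 1 1 h3
  rw [act_act, act_act, one_mul, one_mul, neg_add_cancel, act_one] at h4
  have h5 : (Γ.norm Γ.Δ : ℤ) * -m + 1 = -(N * m - 1) := by rw [← hN]; ring
  rw [h5, ← zsup_conj_le_iff] at h4
  have h6 := Γ.sups_le (g ^ N) z.val
  have h7 := h6.trans h4
  omega

theorem norm_Δ_pos : 1 ≤ Γ.norm Γ.Δ := by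
  by_contra hc
  have h1 : Γ.Δ = 1 := Γ.eq_one_of_norm Γ.Δ_mem (by omega)
  have h2 : leL Γ.P (Γ.Δ ^ (Γ.zinf 1 + 1)) 1 := by simp [leL, h1]
  have := (Γ.le_zinf_iff 1 _).2 h2
  omega

theorem superSummit_nonempty (g : G) : (Γ.superSummit g).Nonempty := by
  obtain ⟨x, hx⟩ : ∃ x, Γ.zinf (x⁻¹ * g * x) = Γ.infs g := (Γ.infs_spec g).1
  obtain ⟨y, hy⟩ := Γ.exists_sups g
  have hx' := (Γ.le_zinf_conj_iff g _ ⟨x⟩).1 hx.ge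
  have hy' := (Γ.zsup_conj_le_iff g _ ⟨y⟩).1 hy.le
  set K := Γ.zsup (y⁻¹ * x)
  have hxB : (⟨x⟩ : Γ.Ord) ≤ Γ.act 1 K ⟨y⟩ := by
    have h1 : leL Γ.P (y⁻¹ * x) (Γ.Δ ^ K) := (Γ.zsup_spec _).1
    change leL Γ.P x (1 * y * Γ.Δ ^ K)
    simpa [leL, mul_assoc] using h1
  have hB : Γ.act g (-Γ.sups g) (Γ.act 1 K ⟨y⟩) ≤ Γ.act 1 K ⟨y⟩ := by
    have := Γ.act_mono 1 K hy'
    rw [act_act] at this ⊢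
    rw [mul_one, add_comm]
    simpa using this
  obtain ⟨z, hz1, hz2⟩ := exists_both (Γ.act_sup g (-Γ.infs g)) (Γ.act_sup g (-Γ.sups g))
    (fun a => by rw [act_act, act_act, add_comm]) hx' hB hxB
    (fun b => Γ.norm (b.val⁻¹ * (Γ.act 1 K ⟨y⟩).val))
    (fun a b hab hbc => Γ.norm_strict' hab hbc)
  rw [← le_zinf_conj_iff] at hz1
  rw [← zsup_conj_le_iff] at hz2
  exact ⟨_, ⟨z.val, rfl⟩, le_antisymm ((Γ.infs_spec g).2 ⟨z.val, rfl⟩) hz1,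
    le_antisymm hz2 (Γ.sups_le g z.val)⟩

theorem sups_pow_eq (g : G) (h : (Γ.sups g : ℝ) = Γ.tsup g) (k : ℕ) :
    Γ.sups (g ^ k) = (k : ℤ) * Γ.sups g := by
  refine le_antisymm (Γ.sups_pow_le g k) ?_
  have h1 := Γ.tsup_le_sups (g ^ k)
  rw [tsup_pow, ← h] at h1
  exact_mod_cast h1

end GarsideGroup

/-- the following are equivalent: (i) `g` is conjugate to a sup-straight
element; (ii) `sup_s(g) = t_sup(g)`; (iii) `sup_s(g^N) = N·sup_s(g)`;
(iv) `sup_s(g^k) = k·sup_s(g)` for all `k ≥ 1`; (v) every `h ∈ [g]^S` is sup-straight. -/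
theorem statement9 {G : Type*} [Group G] (Γ : GarsideGroup G) (g : G) :
    ((∃ x : G, Γ.SupStraight (x⁻¹ * g * x)) ↔ (Γ.sups g : ℝ) = Γ.tsup g) ∧
    (((Γ.sups g : ℝ) = Γ.tsup g) ↔
      Γ.sups (g ^ Γ.norm Γ.Δ) = (Γ.norm Γ.Δ : ℤ) * Γ.sups g) ∧
    ((Γ.sups (g ^ Γ.norm Γ.Δ) = (Γ.norm Γ.Δ : ℤ) * Γ.sups g) ↔
      ∀ k : ℕ, 1 ≤ k → Γ.sups (g ^ k) = (k : ℤ) * Γ.sups g) ∧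
    ((∀ k : ℕ, 1 ≤ k → Γ.sups (g ^ k) = (k : ℤ) * Γ.sups g) ↔
      ∀ h ∈ Γ.superSummit g, Γ.SupStraight h) := by
  have h23 : Γ.sups (g ^ Γ.norm Γ.Δ) = (Γ.norm Γ.Δ : ℤ) * Γ.sups g →
      (Γ.sups g : ℝ) = Γ.tsup g := by
    intro h
    by_contra hc
    have := Γ.sups_pow_lt g (lt_of_le_of_ne (Γ.tsup_le_sups g) (Ne.symm hc))
    omega
  have h24 : (∀ k : ℕ, 1 ≤ k → Γ.sups (g ^ k) = (k : ℤ) * Γ.sups g) →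
      (Γ.sups g : ℝ) = Γ.tsup g := fun h => h23 (h _ Γ.norm_Δ_pos)
  refine ⟨⟨?_, ?_⟩, ⟨fun h => Γ.sups_pow_eq g h _, h23⟩,
    ⟨fun h k _ => Γ.sups_pow_eq g (h23 h) k, fun h => h _ Γ.norm_Δ_pos⟩, ⟨?_, ?_⟩⟩
  · rintro ⟨x, hx⟩
    refine le_antisymm ?_ (Γ.tsup_le_sups g)
    rw [← Γ.tsup_conj g x, ← hx]
    exact_mod_cast Γ.sups_le g x
  · intro h
    obtain ⟨x, hx⟩ := Γ.exists_sups g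
    refine ⟨x, ?_⟩
    unfold GarsideGroup.SupStraight
    rw [Γ.tsup_conj, hx, h]
  · rintro h _ ⟨⟨x, rfl⟩, _, hs⟩
    unfold GarsideGroup.SupStraight
    rw [Γ.tsup_conj, hs, h24 h]
  · intro h k _
    obtain ⟨_, hmem⟩ := Γ.superSummit_nonempty g
    have h1 := h _ hmem
    obtain ⟨⟨x, rfl⟩, _, hs⟩ := hmem
    unfold GarsideGroup.SupStraight at h1
    rw [Γ.tsup_conj, hs] at h1
    exact Γ.sups_pow_eq g h1 k
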